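/- Euler's constant satisfies 6γ² + π² = 1 + 12·Σ_{k=1}^{∞} k·(exp(−e^{k}) − exp(−e^{−k}) + 1) − 24·Σ_{k=1}^{∞} Re(Γ'(2πik)), where Γ' is the derivative of the complex Gamma function. -/

import Mathlib

open Real Complex

open MeasureTheory Set Filter Topology Asymptotics FourierTransform

/-- The function `t ↦ exp (-t) - 1` on `(0, 1]` and `t ↦ exp (-t)` elsewhere. -/
noncomputable def expNegSubOne (t : ℝ) : ℂ :=
  (Real.exp (-t) : ℂ) - indicator (Ioc 0 1) (fun _ => (1 : ℂ)) t

lemma locallyIntegrableOn_expNegSubOne : LocallyIntegrableOn expNegSubOne (Ioi 0) := by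
  refine LocallyIntegrable.locallyIntegrableOn ?_ _
  refine LocallyIntegrable.sub ?_ ?_
  · exact Continuous.locallyIntegrable (by fun_prop)
  · exact (locallyIntegrable_const (1 : ℂ)).indicator measurableSet_Ioc

lemma expNegSubOne_isBigO_atTop (a : ℝ) : expNegSubOne =O[atTop] (· ^ (-a)) := by
  have h : (fun t : ℝ => (Real.exp (-t) : ℂ)) =O[atTop] (· ^ (-a)) := by
    rw [← isBigO_norm_left]
    simp_rw [norm_real, isBigO_norm_left]
    simpa only [neg_one_mul] using (isLittleO_exp_neg_mul_rpow_atTop zero_lt_one _).isBigO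
  refine h.congr' ?_ EventuallyEq.rfl
  filter_upwards [eventually_gt_atTop 1] with t ht
  simp [expNegSubOne, ht]

lemma expNegSubOne_isBigO_zero : expNegSubOne =O[𝓝[>] 0] (· ^ (-(-1 : ℝ))) := by
  refine IsBigO.of_bound 1 ?_
  filter_upwards [Ioc_mem_nhdsGT (zero_lt_one' ℝ)] with t ht
  have h1 : expNegSubOne t = ((Real.exp (-t) - 1 : ℝ) : ℂ) := by
    simp [expNegSubOne, indicator_of_mem ht]
  rw [h1, norm_real, neg_neg, Real.rpow_one, one_mul, Real.norm_eq_abs, Real.norm_eq_abs,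
    abs_of_pos ht.1, abs_le]
  constructor
  · linarith [Real.add_one_le_exp (-t)]
  · linarith [Real.exp_le_one_iff.2 (neg_nonpos.2 ht.1.le), ht.1]

lemma hasDerivAt_mellin_expNegSubOne {s : ℂ} (hs : -1 < s.re) :
    HasDerivAt (mellin expNegSubOne) (mellin (fun t => Real.log t • expNegSubOne t) s) s :=
  (mellin_hasDerivAt_of_isBigO_rpow locallyIntegrableOn_expNegSubOne
    (expNegSubOne_isBigO_atTop _) (lt_add_one _) expNegSubOne_isBigO_zero hs).2

lemma mellin_expNegSubOne_of_re_pos {s : ℂ} (hs : 0 < s.re) :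
    mellin expNegSubOne s = Complex.Gamma s - 1 / s := by
  have h1 : MellinConvergent (fun t : ℝ => (Real.exp (-t) : ℂ)) s := by
    simpa only [MellinConvergent, smul_eq_mul, mul_comm] using
      Complex.GammaIntegral_convergent hs
  have h2 := hasMellin_one_Ioc hs
  rw [Complex.Gamma_eq_integral hs, GammaIntegral_eq_mellin, ← h2.2]
  exact (hasMellin_sub h1 h2.1).2

/-- The Mellin transform of `expNegSubOne` continues `Γ(s) - 1 / s` to the half-plane `-1 < re s`. -/
lemma one_add_mul_mellin_expNegSubOne {s : ℂ} (hs : -1 < s.re) :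
    1 + s * mellin expNegSubOne s = Complex.Gamma (s + 1) := by
  have ho : IsOpen {s : ℂ | -1 < s.re} := isOpen_lt continuous_const continuous_re
  have hf : AnalyticOnNhd ℂ (fun s => 1 + s * mellin expNegSubOne s) {s : ℂ | -1 < s.re} := by
    refine DifferentiableOn.analyticOnNhd (fun z hz => ?_) ho
    exact ((differentiableAt_id.mul
      (hasDerivAt_mellin_expNegSubOne hz).differentiableAt).const_add 1).differentiableWithinAt
  have hg : AnalyticOnNhd ℂ (fun s => Complex.Gamma (s + 1)) {s : ℂ | -1 < s.re} := by
    refine DifferentiableOn.analyticOnNhd (fun z hz => ?_) ho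
    refine DifferentiableAt.differentiableWithinAt ?_
    refine DifferentiableAt.comp (g := Complex.Gamma) z ?_ (by fun_prop)
    refine Complex.differentiableAt_Gamma _ fun m hm => ?_
    have h1 := congrArg re hm
    simp only [add_re, one_re, neg_re, natCast_re] at h1
    have : (0 : ℝ) ≤ m := m.cast_nonneg
    simp only [mem_ofPred_eq] at hz
    linarith
  refine hf.eqOn_of_preconnected_of_eventuallyEq hg (convex_halfSpace_re_gt _).isPreconnected
    (z₀ := 1) (by simp) ?_ hs
  filter_upwards [(isOpen_lt continuous_const continuous_re).mem_nhds
    (show (0 : ℝ) < (1 : ℂ).re by simp)] with z hz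
  have hz' : 0 < z.re := hz
  have hz0 : z ≠ 0 := by rintro rfl; simp at hz'
  rw [mellin_expNegSubOne_of_re_pos hz', Complex.Gamma_add_one z hz0]
  field_simp
  ring

lemma mellin_log_smul_expNegSubOne {s : ℂ} (hs : -1 < s.re) (hs0 : s ≠ 0) :
    mellin (fun t => Real.log t • expNegSubOne t) s = deriv Complex.Gamma s + 1 / s ^ 2 := by
  have hd : DifferentiableAt ℂ Complex.Gamma s := by
    refine Complex.differentiableAt_Gamma _ fun m hm => ?_
    rcases m with _ | m
    · simp [hs0] at hm
    · have h1 := congrArg re hm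
      simp only [neg_re, Nat.cast_add, Nat.cast_one, add_re, one_re, natCast_re] at h1
      have : (0 : ℝ) ≤ m := m.cast_nonneg
      linarith
  have h1 : HasDerivAt (fun z => Complex.Gamma z - z⁻¹) (deriv Complex.Gamma s - -(s ^ 2)⁻¹) s :=
    hd.hasDerivAt.sub (hasDerivAt_inv hs0)
  rw [(hasDerivAt_mellin_expNegSubOne hs).unique (h1.congr_of_eventuallyEq ?_)]
  · rw [sub_neg_eq_add, one_div]
  · filter_upwards [(isOpen_lt continuous_const continuous_re).mem_nhds hs,
      isOpen_ne.mem_nhds hs0] with z hz hz0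
    have h2 := one_add_mul_mellin_expNegSubOne hz
    have hz0' : z ≠ 0 := hz0
    rw [Complex.Gamma_add_one z hz0'] at h2
    field_simp
    linear_combination h2

lemma mellin_expNegSubOne_zero : mellin expNegSubOne 0 = -Real.eulerMascheroniConstant := by
  have h1 : HasDerivAt (fun z => 1 + z * mellin expNegSubOne z)
      (1 * mellin expNegSubOne 0 +
        0 * mellin (fun t => Real.log t • expNegSubOne t) 0) 0 :=
    ((hasDerivAt_id (0 : ℂ)).mul (hasDerivAt_mellin_expNegSubOne (by simp))).const_add 1
  have h2 : HasDerivAt (fun z => Complex.Gamma (z + 1)) (-Real.eulerMascheroniConstant) 0 := by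
    refine HasDerivAt.comp_add_const (f := Complex.Gamma) 0 1 ?_
    simpa using Complex.hasDerivAt_Gamma_one
  have h3 := h1.unique (h2.congr_of_eventuallyEq ?_)
  · simpa using h3
  · filter_upwards [(isOpen_lt continuous_const continuous_re).mem_nhds
      (show (-1 : ℝ) < (0 : ℂ).re by simp)] with z hz
    exact one_add_mul_mellin_expNegSubOne hz

lemma tendsto_sub_sin_div_cube (c : ℝ) :
    Tendsto (fun t : ℝ => (c * t - Real.sin (c * t)) / t ^ 3) (𝓝[≠] 0) (𝓝 (c ^ 3 / 6)) := by
  have h0 : Tendsto (fun t : ℝ => |c| ^ 5 * t ^ 2 / 100) (𝓝[≠] 0) (𝓝 0) := by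
    refine tendsto_nhdsWithin_of_tendsto_nhds ?_
    exact (by fun_prop : Continuous fun t : ℝ => |c| ^ 5 * t ^ 2 / 100).tendsto' _ _ (by simp)
  rw [tendsto_iff_norm_sub_tendsto_zero]
  refine squeeze_zero' (Eventually.of_forall fun _ => norm_nonneg _) ?_ h0
  have h1 : ∀ᶠ t : ℝ in 𝓝[≠] 0, |c * t| < 1 := by
    refine tendsto_nhdsWithin_of_tendsto_nhds ?_ |>.eventually_lt_const zero_lt_one
    exact (by fun_prop : Continuous fun t : ℝ => |c * t|).tendsto' _ _ (by simp)
  filter_upwards [h1, self_mem_nhdsWithin] with t ht ht0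
  have ht0' : t ≠ 0 := ht0
  have hpos : 0 < |t| ^ 3 := by positivity
  have h2 := Real.sin_bound ht.le
  have h3 : (c * t - Real.sin (c * t)) / t ^ 3 - c ^ 3 / 6 =
      -(Real.sin (c * t) - (c * t - (c * t) ^ 3 / 6)) / t ^ 3 := by
    field_simp
    ring
  rw [h3, Real.norm_eq_abs, abs_div, abs_neg, abs_pow, div_le_iff₀ hpos]
  calc _ ≤ _ := h2
    _ = _ := by rw [abs_mul, ← sq_abs t]; ring

/-- The value at `0` is `Γ''(1) / 2`, computed from the reflection formula. -/
lemma mellin_log_smul_expNegSubOne_zero :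
    mellin (fun t => Real.log t • expNegSubOne t) 0 =
      ((Real.eulerMascheroniConstant ^ 2 / 2 + π ^ 2 / 12 : ℝ) : ℂ) := by
  set M := mellin expNegSubOne with hM
  set d := mellin (fun t => Real.log t • expNegSubOne t) 0 with hd
  have hM0 : HasDerivAt M d 0 := hasDerivAt_mellin_expNegSubOne (by simp)
  have hMr : HasDerivAt (fun t : ℝ => M t) d 0 := by
    simpa using HasDerivAt.comp_ofReal (z := 0) (by simpa using hM0)
  have hMn : HasDerivAt (fun t : ℝ => M (-t)) (-d) 0 := by
    have : HasDerivAt (fun z => M (-z)) (-d) 0 := by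
      simpa [Function.comp_def] using
        HasDerivAt.comp (h₂ := M) 0 (by simpa using hM0) (hasDerivAt_neg (0 : ℂ))
    simpa using HasDerivAt.comp_ofReal (z := 0) (by simpa using this)
  have hslope : Tendsto (fun t : ℝ => (M t - M (-t)) / t) (𝓝[≠] 0) (𝓝 (2 * d)) := by
    have h := (hMr.sub hMn).tendsto_slope_zero
    rw [show (2 : ℂ) * d = d - -d by ring]
    refine h.congr fun t => ?_
    simp [div_eq_inv_mul]
  have hprod : Tendsto (fun t : ℝ => M t * M (-t)) (𝓝[≠] 0)
      (𝓝 (Real.eulerMascheroniConstant ^ 2)) := by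
    have h := tendsto_nhdsWithin_of_tendsto_nhds (s := {0}ᶜ)
      (hMr.continuousAt.mul hMn.continuousAt).tendsto
    refine h.trans_eq ?_
    simp [hM, mellin_expNegSubOne_zero, sq]
  have hsin : Tendsto (fun t : ℝ => ((Real.sin (π * t) / t : ℝ) : ℂ)) (𝓝[≠] 0) (𝓝 (π : ℂ)) := by
    refine (continuous_ofReal.tendsto π).comp ?_
    have h : HasDerivAt (fun t : ℝ => Real.sin (π * t)) π 0 := by
      simpa using ((hasDerivAt_id (0 : ℝ)).const_mul π).sin
    refine h.tendsto_slope_zero.congr fun t => ?_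
    simp [div_eq_inv_mul]
  have hlhs := hsin.mul (hslope.sub hprod)
  have hrhs := (continuous_ofReal.tendsto _).comp (tendsto_sub_sin_div_cube π)
  have hev : (fun t : ℝ => ((Real.sin (π * t) / t : ℝ) : ℂ) *
      ((M t - M (-t)) / t - M t * M (-t))) =ᶠ[𝓝[≠] 0]
      (ofReal ∘ fun t : ℝ => (π * t - Real.sin (π * t)) / t ^ 3) := by
    have h1 : ∀ᶠ t : ℝ in 𝓝[≠] 0, t ∈ Ioo (-1 : ℝ) 1 :=
      mem_nhdsWithin_of_mem_nhds (Ioo_mem_nhds (by norm_num) (by norm_num))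
    filter_upwards [h1, self_mem_nhdsWithin] with t ht ht0
    have ht0' : (t : ℂ) ≠ 0 := by exact_mod_cast ht0
    have e1 := one_add_mul_mellin_expNegSubOne (s := t) (by simpa using ht.1)
    have e2 := one_add_mul_mellin_expNegSubOne (s := -t) (by simpa using ht.2)
    rw [Complex.Gamma_add_one _ ht0'] at e1
    have e3 := Complex.Gamma_mul_Gamma_one_sub t
    have hs0 : Complex.sin (π * t) ≠ 0 := by
      rw [Complex.sin_ne_zero_iff]
      intro k hk
      have hk' : (t : ℂ) = k := by
        have : (π : ℂ) ≠ 0 := by exact_mod_cast Real.pi_ne_zero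
        exact mul_left_cancel₀ this (by rw [hk]; ring)
      have hk2 : t = k := by exact_mod_cast hk'
      rw [hk2] at ht ht0
      have h3 : -1 < k := by exact_mod_cast ht.1
      have h4 : k < 1 := by exact_mod_cast ht.2
      obtain rfl : k = 0 := by omega
      simp at ht0
    rw [eq_div_iff hs0, show 1 - (t : ℂ) = -t + 1 by ring, ← e2] at e3
    have e4 : (1 + t * M t) * (1 + -t * M (-t)) * Complex.sin (π * t) = π * t := by
      rw [e1]; linear_combination t * e3
    simp only [Function.comp, ofReal_div, ofReal_sub, ofReal_mul, ofReal_pow, ofReal_sin]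
    field_simp
    linear_combination e4
  have key := tendsto_nhds_unique hlhs (hrhs.congr' hev.symm)
  have hpi : (π : ℂ) ≠ 0 := by exact_mod_cast Real.pi_ne_zero
  have key2 : 2 * d - (Real.eulerMascheroniConstant : ℂ) ^ 2 = π ^ 2 / 6 := by
    apply mul_left_cancel₀ hpi
    rw [key]; push_cast; ring
  push_cast
  linear_combination key2 / 2


lemma log_smul_expNegSubOne_exp_neg (u : ℝ) :
    Real.log (Real.exp (-u)) • expNegSubOne (Real.exp (-u)) =
      ((max u 0 - u * Real.exp (-Real.exp (-u)) : ℝ) : ℂ) := by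
  rw [Real.log_exp, expNegSubOne]
  rcases le_or_gt 0 u with hu | hu
  · have hmem : Real.exp (-u) ∈ Ioc (0 : ℝ) 1 :=
      ⟨Real.exp_pos _, Real.exp_le_one_iff.2 (by linarith)⟩
    rw [indicator_of_mem hmem, max_eq_left hu]
    simp only [real_smul]
    push_cast
    ring
  · rw [indicator_of_notMem, max_eq_right hu.le]
    · simp only [real_smul]
      push_cast
      ring
    · simp [hu]

lemma abs_max_sub_mul_exp_neg_exp_neg_le (u : ℝ) :
    |max u 0 - u * Real.exp (-Real.exp (-u))| ≤ |u| * Real.exp (-|u|) := by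
  rcases le_or_gt 0 u with hu | hu
  · rw [max_eq_left hu, abs_of_nonneg hu,
      show u - u * Real.exp (-Real.exp (-u)) = u * (1 - Real.exp (-Real.exp (-u))) by ring,
      abs_mul, abs_of_nonneg hu]
    refine mul_le_mul_of_nonneg_left ?_ hu
    rw [abs_of_nonneg (by simpa using (Real.exp_pos _).le)]
    linarith [Real.add_one_le_exp (-Real.exp (-u))]
  · rw [max_eq_right hu.le, zero_sub, abs_neg, abs_mul, Real.abs_exp]
    refine mul_le_mul_of_nonneg_left (Real.exp_le_exp.2 (neg_le_neg ?_)) (abs_nonneg _)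
    rw [abs_of_neg hu]
    linarith [Real.add_one_le_exp (-u)]

lemma isBigO_max_sub_mul_exp_neg_exp_neg :
    (fun u : ℝ => ((max u 0 - u * Real.exp (-Real.exp (-u)) : ℝ) : ℂ)) =O[cocompact ℝ]
      fun u : ℝ => |u| ^ (-2 : ℝ) := by
  refine IsBigO.of_bound 6 ?_
  have h0 : ∀ᶠ u : ℝ in cocompact ℝ, u ≠ 0 := by
    filter_upwards [(isCompact_singleton (x := (0 : ℝ))).compl_mem_cocompact] with u hu
    simpa using hu
  filter_upwards [h0] with u hu
  have hpos : 0 < |u| := abs_pos.2 hu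
  rw [norm_real, Real.norm_eq_abs, Real.norm_of_nonneg (by positivity)]
  refine (abs_max_sub_mul_exp_neg_exp_neg_le u).trans ?_
  have h1 := Real.pow_div_factorial_le_exp |u| hpos.le 3
  rw [Real.rpow_neg hpos.le, Real.exp_neg, ← div_eq_mul_inv, ← div_eq_mul_inv,
    div_le_div_iff₀ (Real.exp_pos _) (by positivity)]
  norm_num [Nat.factorial] at h1 ⊢
  rw [← sq_abs]
  linarith [show |u| * |u| ^ 2 = |u| ^ 3 by ring]

lemma mellin_log_smul_expNegSubOne_eq_fourier (n : ℤ) :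
    mellin (fun t => Real.log t • expNegSubOne t) (2 * π * I * n) =
      𝓕 (fun u : ℝ => ((max u 0 - u * Real.exp (-Real.exp (-u)) : ℝ) : ℂ)) n := by
  rw [mellin_eq_fourier]
  have h1 : (2 * π * I * n : ℂ).re = 0 := by simp
  have h2 : (2 * π * I * n : ℂ).im / (2 * π) = n := by
    simp [Real.pi_ne_zero]
  simp only [h1, h2, log_smul_expNegSubOne_exp_neg, neg_zero, zero_mul, Real.exp_zero, one_smul]

lemma norm_Gamma_le_of_re_eq {σ : ℝ} (hσ : 0 < σ) :
    ∃ C : ℝ, 0 ≤ C ∧ ∀ s : ℂ, s.re = σ →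
      ‖Complex.Gamma s‖ ≤ C ∧ ‖deriv Complex.Gamma s‖ ≤ C := by
  set A := ∫ t in Ioi (0 : ℝ), Real.exp (-t) * t ^ (σ - 1)
  set B := ∫ t in Ioi (0 : ℝ), t ^ (σ - 1) * |Real.log t * Real.exp (-t)|
  refine ⟨max (max A B) 0, le_max_right _ _, fun s hs => ⟨?_, ?_⟩⟩
  · refine le_trans ?_ ((le_max_left A B).trans (le_max_left _ _))
    rw [Complex.Gamma_eq_integral (hs ▸ hσ), Complex.GammaIntegral]
    refine (norm_integral_le_integral_norm _).trans_eq ?_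
    refine setIntegral_congr_fun measurableSet_Ioi fun t ht => ?_
    simp [norm_cpow_eq_rpow_re_of_pos ht, hs, Complex.norm_exp]
  · refine le_trans ?_ ((le_max_right A B).trans (le_max_left _ _))
    have hd := Complex.hasDerivAt_GammaIntegral (hs ▸ hσ : 0 < s.re)
    have he : Complex.Gamma =ᶠ[𝓝 s] Complex.GammaIntegral := by
      filter_upwards [(isOpen_lt continuous_const continuous_re).mem_nhds (hs ▸ hσ : 0 < s.re)]
        with z hz using Complex.Gamma_eq_integral hz
    rw [he.deriv_eq, hd.deriv]
    refine (norm_integral_le_integral_norm _).trans_eq ?_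
    refine setIntegral_congr_fun measurableSet_Ioi fun t ht => ?_
    simp [norm_cpow_eq_rpow_re_of_pos ht, hs, abs_mul, Complex.norm_exp]

lemma norm_deriv_Gamma_le_of_re_eq_zero :
    ∃ C : ℝ, ∀ s : ℂ, s.re = 0 → 1 ≤ ‖s‖ → ‖deriv Complex.Gamma s‖ ≤ C / ‖s‖ ^ 2 := by
  obtain ⟨A, hA, hA'⟩ := norm_Gamma_le_of_re_eq one_pos
  obtain ⟨B, hB, hB'⟩ := norm_Gamma_le_of_re_eq two_pos
  refine ⟨B + 2 * A, fun s hs h1 => ?_⟩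
  have hs0 : s ≠ 0 := by rintro rfl; simp at h1; linarith
  have hpos : 0 < ‖s‖ := norm_pos_iff.2 hs0
  have hs1 : s + 1 ≠ 0 := by
    intro h
    have := congrArg re h
    simp [hs] at this
  have hle : ‖s‖ ≤ ‖s + 1‖ := by
    rw [Complex.norm_def, Complex.norm_def]
    refine Real.sqrt_le_sqrt ?_
    simp [normSq_apply, hs]
  have hpos1 : 0 < ‖s + 1‖ := hpos.trans_le hle
  have e1 : deriv Complex.Gamma s = (deriv Complex.Gamma (s + 1) - Complex.Gamma s) / s := by
    rw [Complex.deriv_Gamma_add_one s hs0]; field_simp; ring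
  have e2 : deriv Complex.Gamma (s + 1) =
      (deriv Complex.Gamma (s + 1 + 1) - Complex.Gamma (s + 1)) / (s + 1) := by
    rw [Complex.deriv_Gamma_add_one (s + 1) hs1]; field_simp; ring
  have e3 : Complex.Gamma s = Complex.Gamma (s + 1) / s := by
    rw [Complex.Gamma_add_one s hs0]; field_simp
  have b1 := (hA' (s + 1) (by simp [hs])).1
  have b2 := (hB' (s + 1 + 1) (by simp [hs]; norm_num)).2
  have b3 : ‖deriv Complex.Gamma (s + 1)‖ ≤ (B + A) / ‖s‖ := by
    rw [e2, norm_div]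
    exact div_le_div₀ (by positivity) ((norm_sub_le _ _).trans (add_le_add b2 b1)) hpos hle
  have b4 : ‖Complex.Gamma s‖ ≤ A / ‖s‖ := by
    rw [e3, norm_div]
    gcongr
  calc ‖deriv Complex.Gamma s‖
      ≤ ((B + A) / ‖s‖ + A / ‖s‖) / ‖s‖ := by
        rw [e1, norm_div]
        gcongr
        exact (norm_sub_le _ _).trans (add_le_add b3 b4)
    _ = (B + 2 * A) / ‖s‖ ^ 2 := by field_simp; ring

lemma summable_deriv_Gamma_two_pi_I_mul :
    Summable fun n : ℤ => deriv Complex.Gamma (2 * π * I * n) := by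
  obtain ⟨C, hC⟩ := norm_deriv_Gamma_le_of_re_eq_zero
  have hs : Summable fun n : ℤ => C / (2 * π) ^ 2 * (1 / (n : ℝ) ^ 2) :=
    (Real.summable_one_div_int_pow.2 one_lt_two).mul_left _
  refine hs.of_norm_bounded_eventually ?_
  have h0 : ∀ᶠ n : ℤ in cofinite, n ≠ 0 := by
    filter_upwards [(finite_singleton (0 : ℤ)).compl_mem_cofinite] with n hn using hn
  filter_upwards [h0] with n hn
  have hn1 : (1 : ℝ) ≤ |(n : ℝ)| := by exact_mod_cast Int.one_le_abs hn
  have hnorm : ‖(2 * π * I * n : ℂ)‖ = 2 * π * |(n : ℝ)| := by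
    simp [abs_of_pos Real.pi_pos]
  refine (hC _ (by simp) ?_).trans_eq ?_
  · rw [hnorm]
    nlinarith [Real.pi_gt_three]
  · rw [hnorm, mul_pow, sq_abs]
    ring

lemma re_deriv_Gamma_conj (s : ℂ) :
    (deriv Complex.Gamma ((starRingEnd ℂ) s)).re = (deriv Complex.Gamma s).re := by
  have h : (starRingEnd ℂ) ∘ Complex.Gamma ∘ (starRingEnd ℂ) = Complex.Gamma := by
    ext z
    simp [Complex.Gamma_conj]
  have h1 := deriv_conj_conj (f := Complex.Gamma)
  rw [h] at h1
  conv_rhs => rw [h1]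
  simp

lemma summable_fourier_max_sub_mul_exp_neg_exp_neg :
    Summable fun n : ℤ =>
      𝓕 (fun u : ℝ => ((max u 0 - u * Real.exp (-Real.exp (-u)) : ℝ) : ℂ)) n := by
  have h1 : Summable fun n : ℤ => 1 / (2 * π * I * n : ℂ) ^ 2 := by
    have h : Summable fun n : ℤ => 1 / (2 * π * I : ℂ) ^ 2 * ((1 / (n : ℝ) ^ 2 : ℝ) : ℂ) :=
      (Complex.summable_ofReal.2 (Real.summable_one_div_int_pow.2 one_lt_two)).mul_left _
    refine h.congr fun n => ?_
    push_cast
    rw [mul_pow _ (n : ℂ)]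
    ring
  refine (summable_deriv_Gamma_two_pi_I_mul.add h1).congr_cofinite ?_
  filter_upwards [(finite_singleton (0 : ℤ)).compl_mem_cofinite] with n hn
  have hn0 : (n : ℂ) ≠ 0 := by exact_mod_cast hn
  rw [← mellin_log_smul_expNegSubOne_eq_fourier, mellin_log_smul_expNegSubOne (by simp)]
  simp [hn0, Real.pi_ne_zero]

lemma tsum_int_eq_tsum_re_fourier :
    ∑' n : ℤ, (max (n : ℝ) 0 - n * Real.exp (-Real.exp (-(n : ℝ)))) =
      ∑' n : ℤ, (mellin (fun t => Real.log t • expNegSubOne t) (2 * π * I * n)).re := by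
  have h := Real.tsum_eq_tsum_fourier_of_rpow_decay_of_summable
    (f := fun u : ℝ => ((max u 0 - u * Real.exp (-Real.exp (-u)) : ℝ) : ℂ)) (by fun_prop)
    one_lt_two isBigO_max_sub_mul_exp_neg_exp_neg summable_fourier_max_sub_mul_exp_neg_exp_neg 0
  simp only [zero_add, QuotientAddGroup.mk_zero, fourier_eval_zero, mul_one] at h
  simp only [mellin_log_smul_expNegSubOne_eq_fourier]
  rw [← Complex.re_tsum summable_fourier_max_sub_mul_exp_neg_exp_neg, ← h, ← Complex.ofReal_tsum,
    ofReal_re]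

lemma summable_max_sub_mul_exp_neg_exp_neg :
    Summable fun n : ℤ => max (n : ℝ) 0 - n * Real.exp (-Real.exp (-(n : ℝ))) := by
  have h := (isBigO_max_sub_mul_exp_neg_exp_neg.comp_tendsto
    (Int.isClosedEmbedding_coe_real.tendsto_cocompact))
  rw [cocompact_eq_cofinite] at h
  rw [← Complex.summable_ofReal]
  exact summable_of_isBigO (Real.summable_abs_int_rpow one_lt_two) h

/-- `6γ² + π² = 1 + 12·Σ_{k≥1} k·(exp(−e^k) − exp(−e^{−k}) + 1) − 24·Σ_{k≥1} Re(Γ'(2πik))`,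
where `Γ'` is the derivative of the complex Gamma function. -/
theorem gamma_sq_formula :
    6 * Real.eulerMascheroniConstant ^ 2 + Real.pi ^ 2 =
      1 + 12 * ∑' k : ℕ+, (k : ℝ) *
          (Real.exp (-Real.exp k) - Real.exp (-Real.exp (-(k : ℝ))) + 1)
      - 24 * ∑' k : ℕ+, (deriv Complex.Gamma (2 * Real.pi * Complex.I * (k : ℕ))).re := by
  have hP := tsum_int_eq_tsum_re_fourier
  have hS := summable_max_sub_mul_exp_neg_exp_neg
  have hinj : Function.Injective fun k : ℕ+ => (k : ℤ) := fun a b h => by simpa using h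
  have hinj' : Function.Injective fun k : ℕ+ => -(k : ℤ) := fun a b h => by simpa using h
  have hL : ∑' n : ℤ, (max (n : ℝ) 0 - n * Real.exp (-Real.exp (-(n : ℝ)))) =
      ∑' k : ℕ+, (k : ℝ) * (Real.exp (-Real.exp k) - Real.exp (-Real.exp (-(k : ℝ))) + 1) := by
    rw [tsum_int_eq_zero_add_tsum_pnat hS]
    have s1 := hS.comp_injective hinj
    have s2 := hS.comp_injective hinj'
    have hadd := s1.tsum_add s2
    simp only [Function.comp_def] at hadd
    rw [add_assoc, ← hadd]
    simp only [Int.cast_zero, max_self, zero_mul, sub_zero, zero_add]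
    refine tsum_congr fun k => ?_
    have hk : (0 : ℝ) ≤ k := by positivity
    push_cast
    rw [max_eq_left hk, max_eq_right (by linarith)]
    simp only [neg_neg]
    ring
  have hR : ∑' n : ℤ, (mellin (fun t => Real.log t • expNegSubOne t) (2 * π * I * n)).re =
      Real.eulerMascheroniConstant ^ 2 / 2 + π ^ 2 / 12 +
        2 * ∑' k : ℕ+, (deriv Complex.Gamma (2 * π * I * (k : ℕ))).re - 1 / 12 := by
    have hval : ∀ n : ℤ, n ≠ 0 →
        (mellin (fun t => Real.log t • expNegSubOne t) (2 * π * I * n)).re =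
          (deriv Complex.Gamma (2 * π * I * n)).re - 1 / (4 * π ^ 2) * (1 / (n : ℝ) ^ 2) := by
      intro n hn
      have hn0 : (n : ℂ) ≠ 0 := by exact_mod_cast hn
      rw [mellin_log_smul_expNegSubOne (by simp) (by simp [hn0, Real.pi_ne_zero]), add_re]
      have : (1 / (2 * π * I * n : ℂ) ^ 2) = ((-(1 / (4 * π ^ 2) * (1 / (n : ℝ) ^ 2)) : ℝ) : ℂ) := by
        have : (2 * π * I * n : ℂ) ^ 2 = -(4 * π ^ 2 * n ^ 2) := by
          linear_combination (4 * π ^ 2 * n ^ 2 : ℂ) * I_sq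
        rw [this]
        push_cast
        rw [one_div_mul_one_div, div_neg]
      rw [this, ofReal_re, sub_eq_add_neg]
    have hsum : Summable fun n : ℤ =>
        (mellin (fun t => Real.log t • expNegSubOne t) (2 * π * I * n)).re := by
      simp only [mellin_log_smul_expNegSubOne_eq_fourier]
      exact (Complex.hasSum_re summable_fourier_max_sub_mul_exp_neg_exp_neg.hasSum).summable
    have heven : Function.Even fun n : ℤ =>
        (mellin (fun t => Real.log t • expNegSubOne t) (2 * π * I * n)).re := by
      intro n
      rcases eq_or_ne n 0 with rfl | hn
      · simp
      · simp only
        rw [hval n hn, hval (-n) (neg_ne_zero.2 hn), ← re_deriv_Gamma_conj]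
        simp [map_ofNat]
    rw [tsum_int_eq_zero_add_tsum_pnat hsum]
    have hneg : ∀ k : ℕ+, (mellin (fun t => Real.log t • expNegSubOne t)
        (2 * π * I * ((-(k : ℤ) : ℤ) : ℂ))).re =
        (mellin (fun t => Real.log t • expNegSubOne t) (2 * π * I * ((k : ℤ) : ℂ))).re :=
      fun k => heven k
    have hzero : (mellin (fun t => Real.log t • expNegSubOne t) (2 * π * I * ((0 : ℤ) : ℂ))).re =
        Real.eulerMascheroniConstant ^ 2 / 2 + π ^ 2 / 12 := by
      rw [Int.cast_zero, mul_zero, mellin_log_smul_expNegSubOne_zero, ofReal_re]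
    have hzeta : HasSum (fun k : ℕ+ => 1 / (((k : ℤ) : ℝ)) ^ 2) (π ^ 2 / 6) := by
      have h := (PNat.coe_injective.hasSum_iff (f := fun n : ℕ => (1 : ℝ) / (n : ℝ) ^ 2)
        (a := π ^ 2 / 6)
        fun n hn => ?_).2 hasSum_zeta_two
      · simpa [Function.comp_def] using h
      · rcases Nat.eq_zero_or_pos n with rfl | h
        · simp
        · exact absurd ⟨⟨n, h⟩, rfl⟩ hn
    have hG : Summable fun k : ℕ+ => (deriv Complex.Gamma (2 * π * I * ((k : ℤ) : ℂ))).re :=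
      (Complex.hasSum_re summable_deriv_Gamma_two_pi_I_mul.hasSum).summable.comp_injective hinj
    have hpos : ∑' k : ℕ+, (mellin (fun t => Real.log t • expNegSubOne t)
        (2 * π * I * ((k : ℤ) : ℂ))).re =
        ∑' k : ℕ+, (deriv Complex.Gamma (2 * π * I * (k : ℕ))).re - 1 / 24 := by
      rw [tsum_congr fun k : ℕ+ => hval k (by simp),
        hG.tsum_sub (hzeta.summable.mul_left _), tsum_mul_left, hzeta.tsum_eq]
      have := Real.pi_ne_zero
      congr 1
      field_simp
      norm_num
    rw [tsum_congr hneg, hzero, hpos]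
    ring
  rw [hL, hR] at hP
  linarith
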